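/- arXiv:2201.00640 — 2 statements merged into one kernel-verified Lean document; each statement's English description precedes it below -/
import Mathlib

section
/- Let a_n denote the number of decorated Dyck paths of length 2n having no peak at level 1. Then for every n \ge 1 the recurrence 3(n+4)\,a_{n+3} - (17n+41)\,a_{n+2} + 9n\,a_{n+1} + 5(n+1)\,a_n = 0 holds. (This is the recursion conjectured for OEIS sequence A128723.) -/
/-- A step of a decorated path: up, black down, or red down. -/
inductive Step : Type
  | U : Step
  | D : Step
  | R : Step
  deriving DecidableEq

/-- The height change of a step. -/
def stepVal : Step → ℤ
  | Step.U => 1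
  | Step.D => -1
  | Step.R => -1

/-- The final height of a word of steps. -/
def height (w : List Step) : ℤ := (w.map stepVal).sum

/-- A decorated path: all prefixes have nonnegative height, `U` is never
immediately followed by `R`, and `R` is never immediately followed by `U`. -/
def IsDecoratedPath (w : List Step) : Prop :=
  (∀ p : List Step, p <+: w → 0 ≤ height p) ∧
    ¬ [Step.U, Step.R] <:+: w ∧ ¬ [Step.R, Step.U] <:+: w

/-- A decorated Dyck path: a decorated path with final height 0. -/
def IsDecoratedDyck (w : List Step) : Prop :=
  IsDecoratedPath w ∧ height w = 0

/-- The path has a peak at level 1: some `U` taken from height 0 is immediately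
followed by a down-step (`D` or `R`). -/
def HasPeakAtLevelOne (w : List Step) : Prop :=
  ∃ p q : List Step, ∃ d : Step, (d = Step.D ∨ d = Step.R) ∧
    w = p ++ Step.U :: d :: q ∧ height p = 0

/-- The number of decorated Dyck paths of length `2 * n` having no peak at level 1. -/
noncomputable def a (n : ℕ) : ℕ :=
  Nat.card {w : List Step // w.length = 2 * n ∧ IsDecoratedDyck w ∧ ¬ HasPeakAtLevelOne w}


section Words

/-- Suffix `w` is admissible after last letter `l` at height `h`. -/
def okw : Step → ℕ → List Step → Prop
  | _, h, [] => h = 0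
  | l, h, Step.U :: w => l ≠ Step.R ∧ okw Step.U (h + 1) w
  | l, h, Step.D :: w => 1 ≤ h ∧ ¬ (l = Step.U ∧ h = 1) ∧ okw Step.D (h - 1) w
  | l, h, Step.R :: w => 1 ≤ h ∧ l ≠ Step.U ∧ okw Step.R (h - 1) w

/-- The full condition on a suffix. -/
def goodw (l : Step) (h : ℤ) (w : List Step) : Prop :=
  (∀ p : List Step, p <+: w → 0 ≤ h + height p) ∧ h + height w = 0 ∧
    ¬ [Step.U, Step.R] <:+: (l :: w) ∧ ¬ [Step.R, Step.U] <:+: (l :: w) ∧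
    ¬ (∃ p q : List Step, ∃ d : Step, (d = Step.D ∨ d = Step.R) ∧
      l :: w = p ++ Step.U :: d :: q ∧ h - stepVal l + height p = 0)

lemma height_nil : height [] = 0 := rfl

lemma height_cons (s : Step) (w : List Step) : height (s :: w) = stepVal s + height w := by
  simp [height]

lemma prefix_cons_cond (h : ℤ) (s : Step) (w : List Step) (h0 : 0 ≤ h) :
    (∀ p : List Step, p <+: s :: w → 0 ≤ h + height p) ↔
    (∀ p : List Step, p <+: w → 0 ≤ (h + stepVal s) + height p) := by
  constructor
  · intro H p hp
    have := H (s :: p) (by simpa using hp)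
    rw [height_cons] at this
    linarith
  · intro H p hp
    cases p with
    | nil => simpa [height_nil] using h0
    | cons t p =>
      rw [List.cons_prefix_cons] at hp
      obtain ⟨rfl, hp⟩ := hp
      have := H p hp
      rw [height_cons]
      linarith

lemma infix_pair (x y l s : Step) (w : List Step) :
    [x, y] <:+: (l :: s :: w) ↔ (l = x ∧ s = y) ∨ [x, y] <:+: (s :: w) := by
  rw [List.infix_cons_iff, @eq_comm _ l, @eq_comm _ s]
  simp [List.cons_prefix_cons]

lemma peak_cons (l s : Step) (h : ℤ) (w : List Step) :
    (∃ p q : List Step, ∃ d : Step, (d = Step.D ∨ d = Step.R) ∧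
      l :: s :: w = p ++ Step.U :: d :: q ∧ h - stepVal l + height p = 0) ↔
    (l = Step.U ∧ s ≠ Step.U ∧ h = 1) ∨
    (∃ p q : List Step, ∃ d : Step, (d = Step.D ∨ d = Step.R) ∧
      s :: w = p ++ Step.U :: d :: q ∧ (h + stepVal s) - stepVal s + height p = 0) := by
  constructor
  · rintro ⟨p, q, d, hd, he, hh⟩
    cases p with
    | nil =>
      left
      simp only [List.nil_append, List.cons.injEq] at he
      obtain ⟨rfl, rfl, rfl⟩ := he
      refine ⟨rfl, by rcases hd with rfl | rfl <;> simp, ?_⟩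
      simp [height_nil, stepVal] at hh
      linarith
    | cons t p =>
      right
      simp only [List.cons_append, List.cons.injEq] at he
      obtain ⟨rfl, he⟩ := he
      refine ⟨p, q, d, hd, he, ?_⟩
      rw [height_cons] at hh
      linarith
  · rintro (⟨rfl, hs, rfl⟩ | ⟨p, q, d, hd, he, hh⟩)
    · refine ⟨[], w, s, ?_, rfl, by simp [height_nil, stepVal]⟩
      cases s <;> simp_all
    · refine ⟨l :: p, q, d, hd, by simp [he], ?_⟩
      rw [height_cons]
      linarith

lemma goodw_nil (l : Step) (h : ℕ) : goodw l h [] ↔ h = 0 := by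
  unfold goodw
  constructor
  · rintro ⟨-, h2, -⟩
    simpa [height_nil] using h2
  · rintro rfl
    refine ⟨by simp [height_nil], by simp [height_nil], ?_, ?_, ?_⟩
    · intro H
      simpa using H.length_le
    · intro H
      simpa using H.length_le
    · rintro ⟨p, q, d, -, he, -⟩
      have := congrArg List.length he
      simp at this
      omega

lemma goodw_cons (l s : Step) (h : ℤ) (w : List Step) (h0 : 0 ≤ h) :
    goodw l h (s :: w) ↔ ¬ (l = Step.U ∧ s = Step.R) ∧ ¬ (l = Step.R ∧ s = Step.U) ∧
      ¬ (l = Step.U ∧ s ≠ Step.U ∧ h = 1) ∧ goodw s (h + stepVal s) w := by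
  unfold goodw
  rw [prefix_cons_cond h s w h0, infix_pair, infix_pair, peak_cons, height_cons, ← add_assoc]
  simp only [not_or]
  constructor
  · rintro ⟨h1, h2, ⟨h3, h4⟩, ⟨h5, h6⟩, h7, h8⟩
    exact ⟨h3, h5, h7, h1, h2, h4, h6, h8⟩
  · rintro ⟨h3, h5, h7, h1, h2, h4, h6, h8⟩
    exact ⟨h1, h2, ⟨h3, h4⟩, ⟨h5, h6⟩, h7, h8⟩

lemma goodw_nonneg (l : Step) (h : ℤ) (w : List Step) (H : goodw l h w) : 0 ≤ h := by
  simpa [height_nil] using H.1 [] (by simp)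

lemma okw_iff (w : List Step) : ∀ (l : Step) (h : ℕ), okw l h w ↔ goodw l h w := by
  induction w with
  | nil => intro l h; rw [goodw_nil]; simp [okw]
  | cons s w ih =>
    intro l h
    rw [goodw_cons l s h w (by positivity)]
    cases s with
    | U =>
      simp only [okw, ih, stepVal]
      push_cast
      simp
    | D =>
      simp only [okw, ih, stepVal]
      rcases h with _ | h
      · simp
        intro H
        have := goodw_nonneg _ _ _ H
        simp at this
      · simp
    | R =>
      simp only [okw, ih, stepVal]
      rcases h with _ | h
      · simp
        intro _ H
        have := goodw_nonneg _ _ _ H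
        simp at this
      · simp
        tauto

lemma okw_start (w : List Step) :
    okw Step.D 0 w ↔ IsDecoratedDyck w ∧ ¬ HasPeakAtLevelOne w := by
  rw [okw_iff]
  unfold goodw IsDecoratedDyck IsDecoratedPath HasPeakAtLevelOne
  have e1 : ∀ y z : Step, y ≠ Step.D → ([y, z] <:+: (Step.D :: w) ↔ [y, z] <:+: w) := by
    intro y z hy
    rw [List.infix_cons_iff]
    simp [List.cons_prefix_cons, hy]
  have e2 : (∃ p q : List Step, ∃ d : Step, (d = Step.D ∨ d = Step.R) ∧
      Step.D :: w = p ++ Step.U :: d :: q ∧ ((0 : ℕ) : ℤ) - stepVal Step.D + height p = 0) ↔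
      (∃ p q : List Step, ∃ d : Step, (d = Step.D ∨ d = Step.R) ∧
        w = p ++ Step.U :: d :: q ∧ height p = 0) := by
    constructor
    · rintro ⟨p, q, d, hd, he, hh⟩
      cases p with
      | nil => simp at he
      | cons t p =>
        simp only [List.cons_append, List.cons.injEq] at he
        obtain ⟨rfl, he⟩ := he
        refine ⟨p, q, d, hd, he, ?_⟩
        rw [height_cons] at hh
        push_cast at hh
        linarith
    · rintro ⟨p, q, d, hd, he, hh⟩
      refine ⟨Step.D :: p, q, d, hd, by simp [he], ?_⟩
      rw [height_cons]
      push_cast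
      linarith
  rw [e1 _ _ (by simp), e1 _ _ (by simp), e2]
  simp only [Nat.cast_zero, zero_add]
  tauto

/-- The finite set of admissible suffixes of length `n`. -/
def fw : Step → ℕ → ℕ → Finset (List Step)
  | _, h, 0 => if h = 0 then {[]} else ∅
  | l, h, n + 1 =>
    (if l ≠ Step.R then (fw Step.U (h + 1) n).image (List.cons Step.U) else ∅) ∪
    ((if 1 ≤ h ∧ ¬ (l = Step.U ∧ h = 1) then
      (fw Step.D (h - 1) n).image (List.cons Step.D) else ∅) ∪
    (if 1 ≤ h ∧ l ≠ Step.U then (fw Step.R (h - 1) n).image (List.cons Step.R) else ∅))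

lemma mem_fw (n : ℕ) : ∀ (l : Step) (h : ℕ) (w : List Step),
    w ∈ fw l h n ↔ w.length = n ∧ okw l h w := by
  induction n with
  | zero =>
    intro l h w
    simp only [fw]
    cases w with
    | nil => by_cases hh : h = 0 <;> simp [okw, hh]
    | cons s w => by_cases hh : h = 0 <;> simp [hh]
  | succ n ih =>
    intro l h w
    simp only [fw, Finset.mem_union]
    have key : ∀ (c : Prop) [Decidable c] (A : Finset (List Step)) (s : Step),
        (w ∈ (if c then A.image (List.cons s) else ∅)) ↔ c ∧ ∃ v ∈ A, s :: v = w := by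
      intro c _ A s
      split_ifs with hc <;> simp [hc]
    rw [key, key, key]
    simp only [ih]
    cases w with
    | nil => simp
    | cons s w => cases s <;> simp [okw] <;> tauto

lemma card_fw_succ (l : Step) (h n : ℕ) :
    (fw l h (n + 1)).card = (if l ≠ Step.R then (fw Step.U (h + 1) n).card else 0) +
    ((if 1 ≤ h ∧ ¬ (l = Step.U ∧ h = 1) then (fw Step.D (h - 1) n).card else 0) +
    (if 1 ≤ h ∧ l ≠ Step.U then (fw Step.R (h - 1) n).card else 0)) := by
  have key : ∀ (c : Prop) [Decidable c] (A : Finset (List Step)) (s : Step) (w : List Step),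
        (w ∈ (if c then A.image (List.cons s) else ∅)) ↔ c ∧ ∃ v ∈ A, s :: v = w := by
      intro c _ A s w
      split_ifs with hc <;> simp [hc]
  have kc : ∀ (c : Prop) [Decidable c] (A : Finset (List Step)) (s : Step),
        (if c then A.image (List.cons s) else ∅).card = if c then A.card else 0 := by
      intro c _ A s
      split_ifs with hc
      · exact Finset.card_image_of_injective _ List.cons_injective
      · simp
  rw [fw, Finset.card_union_of_disjoint, Finset.card_union_of_disjoint, kc, kc, kc]
  · rw [Finset.disjoint_left]
    intro w
    rw [key, key]
    rintro ⟨-, v, -, rfl⟩ ⟨-, v', -, hv⟩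
    simp at hv
  · rw [Finset.disjoint_left]
    intro w
    rw [Finset.mem_union, key, key, key]
    rintro ⟨-, v, -, rfl⟩ (⟨-, v', -, hv⟩ | ⟨-, v', -, hv⟩) <;> simp at hv

lemma a_eq (n : ℕ) : a n = (fw Step.D 0 (2 * n)).card := by
  unfold a
  rw [← Nat.card_eq_finsetCard]
  apply Nat.card_congr
  apply Equiv.subtypeEquivRight
  intro w
  rw [mem_fw, okw_start]

end Words

section Series

open PowerSeries

lemma exists_S : ∃ S : PowerSeries ℚ, S = 1 + X ^ 2 * S ^ 2 + X ^ 2 * (S - 1) := by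
  have hu : (1 - X ^ 2 : PowerSeries ℚ) * (1 - X ^ 2 : PowerSeries ℚ)⁻¹ = 1 :=
    PowerSeries.mul_inv_cancel _ (by simp)
  set y : PowerSeries ℚ := X ^ 2 * (1 - X ^ 2 : PowerSeries ℚ)⁻¹ with hy
  have hs : HasSubst y := HasSubst.of_constantCoeff_zero' (by simp [hy])
  have hc := congrArg (PowerSeries.map (Nat.castRingHom ℚ)) catalanSeries_sq_mul_X_add_one
  have h2 := congrArg (substAlgHom (R := ℚ) hs) hc
  simp only [map_add, map_mul, map_pow, map_one, PowerSeries.map_X] at h2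
  rw [substAlgHom_X] at h2
  set S := substAlgHom (R := ℚ) hs (PowerSeries.map (Nat.castRingHom ℚ) catalanSeries)
  refine ⟨S, ?_⟩
  linear_combination (-(1 - X ^ 2)) * h2 + S ^ 2 * (1 - X ^ 2) * hy + S ^ 2 * X ^ 2 * hu

lemma exists_T (S : PowerSeries ℚ) :
    ∃ T : PowerSeries ℚ, T = 1 + X ^ 2 * (S - 1) * (T + 1) := by
  have hu : (1 - X ^ 2 * (S - 1) : PowerSeries ℚ) * (1 - X ^ 2 * (S - 1))⁻¹ = 1 :=
    PowerSeries.mul_inv_cancel _ (by simp)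
  refine ⟨(1 + X ^ 2 * (S - 1)) * (1 - X ^ 2 * (S - 1))⁻¹, ?_⟩
  linear_combination (1 + X ^ 2 * (S - 1)) * hu

lemma card_eq_coeff (S T : PowerSeries ℚ) (hS : S = 1 + X ^ 2 * S ^ 2 + X ^ 2 * (S - 1))
    (hT : T = 1 + X ^ 2 * (S - 1) * (T + 1)) (n : ℕ) :
    (((fw Step.D 0 n).card : ℚ) = coeff n T) ∧
    (((fw Step.R 0 n).card : ℚ) = coeff n (1 : PowerSeries ℚ)) ∧
    (((fw Step.U 1 n).card : ℚ) = coeff n (X * ((T + 1) * (S - 1)))) ∧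
    (∀ h : ℕ, ((fw Step.D (h + 1) n).card : ℚ)
      = coeff n (X * ((T + 1) * S * (X * (S + 1)) ^ h))) ∧
    (∀ h : ℕ, ((fw Step.R (h + 1) n).card : ℚ)
      = coeff n (X * ((T + 1) * (X * (S + 1)) ^ h))) ∧
    (∀ h : ℕ, ((fw Step.U (h + 2) n).card : ℚ)
      = coeff n ((T + 1) * (S - 1) * (X * (S + 1)) ^ h)) := by
  have hV : ∀ h : ℕ, (T + 1) * (S - 1) * (X * (S + 1)) ^ h
      = X * ((T + 1) * (S - 1) * (X * (S + 1)) ^ (h + 1)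
        + X * ((T + 1) * S * (X * (S + 1)) ^ h)) := by
    intro h
    rw [pow_succ]
    linear_combination (T + 1) * (X * (S + 1)) ^ h * hS
  have hT' : T = 1 + X * (X * ((T + 1) * (S - 1))) := by linear_combination hT
  induction n with
  | zero =>
    refine ⟨?_, ?_, ?_, ?_, ?_, ?_⟩
    · rw [hT']; simp [fw]
    · simp [fw]
    · simp [fw]
    · intro h; simp [fw]
    · intro h; simp [fw]
    · intro h; rw [hV]; simp [fw]
  | succ n ih =>
    obtain ⟨i1, i2, i3, i4, i5, i6⟩ := ih
    refine ⟨?_, ?_, ?_, ?_, ?_, ?_⟩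
    · rw [hT', card_fw_succ, map_add, coeff_succ_X_mul, ← i3]
      simp [coeff_one]
    · rw [card_fw_succ]
      simp [coeff_one]
    · have := i6 0
      rw [card_fw_succ, coeff_succ_X_mul]
      simp at this ⊢
      exact this
    · intro h
      rw [card_fw_succ, coeff_succ_X_mul]
      have j6 := i6 h
      rcases h with _ | h
      · simp only [zero_add, pow_zero, mul_one] at j6 ⊢
        simp [i1, i2, j6, -coeff_one]
        rw [← map_add, ← map_add]
        congr 1
        ring
      · have j4 := i4 h
        have j5 := i5 h
        simp at j4 j5 j6 ⊢
        rw [j4, j5, j6, ← map_add, ← map_add]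
        congr 1
        rw [pow_succ]
        ring
    · intro h
      rw [card_fw_succ, coeff_succ_X_mul]
      rcases h with _ | h
      · simp [i1, i2]
      · have j4 := i4 h
        have j5 := i5 h
        simp at j4 j5 ⊢
        rw [j4, j5, ← map_add]
        congr 1
        rw [pow_succ]
        ring
    · intro h
      rw [card_fw_succ, hV, coeff_succ_X_mul, map_add, ← i4, ← i6]
      simp

lemma ode (S T : PowerSeries ℚ) (hS : S = 1 + X ^ 2 * S ^ 2 + X ^ 2 * (S - 1))
    (hT : T = 1 + X ^ 2 * (S - 1) * (T + 1)) :
    X * (3 - 17 * X ^ 2 + 9 * X ^ 4 + 5 * X ^ 6) * (d⁄dX ℚ T)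
      + 2 * ((3 - 7 * X ^ 2 - 9 * X ^ 4 + 5 * X ^ 6) * T
        + (-3 + 7 * X ^ 2 - 9 * X ^ 4 + 5 * X ^ 6)) = 0 := by
  have hE : X ^ 2 * (3 + X ^ 2) * T ^ 2 - 2 * (1 - X ^ 4) * T
      + (1 - X ^ 2) * (2 - X ^ 2) = 0 := by
    linear_combination (T - 1 + X ^ 2 * (S - 1) * (T + 1)) * hT
      - (1 - 3 * X ^ 2) * (T + 1) * hT - X ^ 2 * (T + 1) ^ 2 * hS
  have hD : (2 * (X ^ 2 * (3 + X ^ 2)) * T - 2 * (1 - X ^ 4)) * (d⁄dX ℚ T)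
      + 2 * X * ((3 + 2 * X ^ 2) * T ^ 2 + 4 * X ^ 2 * T + (-3 + 2 * X ^ 2)) = 0 := by
    have hE' : 3 • (X ^ 2 * T ^ 2) + X ^ 4 * T ^ 2 - 2 • T + 2 • (X ^ 4 * T)
        + (1 : PowerSeries ℚ) + 1 - 3 • X ^ 2 + X ^ 4 = 0 := by
      simp only [nsmul_eq_mul]
      push_cast
      linear_combination hE
    have h := congrArg (d⁄dX ℚ) hE'
    simp only [map_add, map_sub, Derivation.leibniz, Derivation.leibniz_pow,
      Derivation.map_one_eq_zero, derivative_X, smul_eq_mul, nsmul_eq_mul, map_zero] at h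
    have k2 : (d⁄dX ℚ) (2 : PowerSeries ℚ) = 0 := (d⁄dX ℚ).map_natCast 2
    have k3 : (d⁄dX ℚ) (3 : PowerSeries ℚ) = 0 := (d⁄dX ℚ).map_natCast 3
    push_cast at h
    rw [k2, k3] at h
    linear_combination h
  have hne : (2 * (X ^ 2 * (3 + X ^ 2)) * T - 2 * (1 - X ^ 4) : PowerSeries ℚ) ≠ 0 := by
    intro h0
    have := congrArg (constantCoeff (R := ℚ)) h0
    have k2 : constantCoeff (2 : PowerSeries ℚ) = 2 := map_ofNat _ 2
    simp [k2] at this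
  apply mul_left_cancel₀ hne
  linear_combination X * (3 - 17 * X ^ 2 + 9 * X ^ 4 + 5 * X ^ 6) * hD
    + 2 * (2 * (3 - 7 * X ^ 2 - 9 * X ^ 4 + 5 * X ^ 6)
      - (1 - X ^ 2) * (1 - 5 * X ^ 2) * (3 + 2 * X ^ 2)) * hE

lemma rec_coeff (T : PowerSeries ℚ)
    (h : X * (3 - 17 * X ^ 2 + 9 * X ^ 4 + 5 * X ^ 6) * (d⁄dX ℚ T)
      + 2 * ((3 - 7 * X ^ 2 - 9 * X ^ 4 + 5 * X ^ 6) * T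
        + (-3 + 7 * X ^ 2 - 9 * X ^ 4 + 5 * X ^ 6)) = 0) (n : ℕ) (hn : 1 ≤ n) :
    3 * ((n : ℚ) + 4) * coeff (2 * (n + 3)) T - (17 * n + 41) * coeff (2 * (n + 2)) T
      + 9 * n * coeff (2 * (n + 1)) T + 5 * (n + 1) * coeff (2 * n) T = 0 := by
  have h' : (3 : ℚ) • (X ^ 1 * (d⁄dX ℚ T)) - (17 : ℚ) • (X ^ 3 * (d⁄dX ℚ T))
      + (9 : ℚ) • (X ^ 5 * (d⁄dX ℚ T)) + (5 : ℚ) • (X ^ 7 * (d⁄dX ℚ T))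
      + (6 : ℚ) • T - (14 : ℚ) • (X ^ 2 * T) - (18 : ℚ) • (X ^ 4 * T) + (10 : ℚ) • (X ^ 6 * T)
      - (6 : ℚ) • 1 + (14 : ℚ) • X ^ 2 - (18 : ℚ) • X ^ 4 + (10 : ℚ) • X ^ 6 = 0 := by
    simp only [ofNat_smul_eq_nsmul, nsmul_eq_mul]
    push_cast
    linear_combination h
  obtain ⟨k, rfl⟩ : ∃ k, n = k + 1 := ⟨n - 1, by omega⟩
  have c := congrArg (coeff (2 * k + 8)) h'
  have d1 : coeff (2 * k + 8) (X ^ 1 * (d⁄dX ℚ T)) = coeff (2 * k + 8) T * (2 * k + 8) := by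
    rw [show 2 * k + 8 = (2 * k + 7) + 1 by ring, coeff_X_pow_mul, coeff_derivative]
    push_cast; ring
  have d2 : coeff (2 * k + 8) (X ^ 3 * (d⁄dX ℚ T)) = coeff (2 * k + 6) T * (2 * k + 6) := by
    rw [show 2 * k + 8 = (2 * k + 5) + 3 by ring, coeff_X_pow_mul, coeff_derivative]
    push_cast; ring
  have d3 : coeff (2 * k + 8) (X ^ 5 * (d⁄dX ℚ T)) = coeff (2 * k + 4) T * (2 * k + 4) := by
    rw [show 2 * k + 8 = (2 * k + 3) + 5 by ring, coeff_X_pow_mul, coeff_derivative]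
    push_cast; ring
  have d4 : coeff (2 * k + 8) (X ^ 7 * (d⁄dX ℚ T)) = coeff (2 * k + 2) T * (2 * k + 2) := by
    rw [show 2 * k + 8 = (2 * k + 1) + 7 by ring, coeff_X_pow_mul, coeff_derivative]
    push_cast; ring
  have e2 : coeff (2 * k + 8) (X ^ 2 * T) = coeff (2 * k + 6) T := coeff_X_pow_mul T 2 _
  have e4 : coeff (2 * k + 8) (X ^ 4 * T) = coeff (2 * k + 4) T := coeff_X_pow_mul T 4 _
  have e6 : coeff (2 * k + 8) (X ^ 6 * T) = coeff (2 * k + 2) T := coeff_X_pow_mul T 6 _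
  simp only [map_add, map_sub, map_smul, smul_eq_mul, d1, d2, d3, d4, e2, e4, e6, coeff_X_pow,
    coeff_one, map_zero] at c
  rw [if_neg (by omega), if_neg (by omega), if_neg (by omega), if_neg (by omega)] at c
  rw [show 2 * (k + 1 + 3) = 2 * k + 8 by ring, show 2 * (k + 1 + 2) = 2 * k + 6 by ring,
    show 2 * (k + 1 + 1) = 2 * k + 4 by ring, show 2 * (k + 1) = 2 * k + 2 by ring]
  push_cast
  linear_combination c / 2

end Series

theorem A128723_recurrence (n : ℕ) (hn : 1 ≤ n) :
    3 * ((n : ℤ) + 4) * (a (n + 3) : ℤ) - (17 * (n : ℤ) + 41) * (a (n + 2) : ℤ)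
      + 9 * (n : ℤ) * (a (n + 1) : ℤ) + 5 * ((n : ℤ) + 1) * (a n : ℤ) = 0 := by
  obtain ⟨S, hS⟩ := exists_S
  obtain ⟨T, hT⟩ := exists_T S
  have h := rec_coeff T (ode S T hS hT) n hn
  have e : ∀ m : ℕ, PowerSeries.coeff (2 * m) T = (a m : ℚ) := by
    intro m
    rw [a_eq, (card_eq_coeff S T hS hT (2 * m)).1]
  rw [e, e, e, e] at h
  exact_mod_cast h
end

section
/- For n = 0, 1, ..., 9, the number of partial dual decorated paths of length n having no peak at level 1 (the final height may be any nonnegative integer) is, respectively, 1, 2, 4, 10, 24, 56, 134, 318, 764, 1824. -/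
/-- A step of a dual decorated path: black up, blue up, or down. -/
inductive DStep : Type
  | U : DStep
  | V : DStep
  | D : DStep
  deriving DecidableEq

/-- The height change of a dual step. -/
def dstepVal : DStep → ℤ
  | DStep.U => 1
  | DStep.V => 1
  | DStep.D => -1

/-- The final height of a word of dual steps. -/
def dheight (w : List DStep) : ℤ := (w.map dstepVal).sum

/-- A dual decorated path: all prefixes have nonnegative height, `V` is never
immediately followed by `D`, and `D` is never immediately followed by `V`. -/
def IsDualDecoratedPath (w : List DStep) : Prop :=
  (∀ p : List DStep, p <+: w → 0 ≤ dheight p) ∧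
    ¬ [DStep.V, DStep.D] <:+: w ∧ ¬ [DStep.D, DStep.V] <:+: w

/-- A dual decorated Dyck path: a dual decorated path with final height 0. -/
def IsDualDecoratedDyck (w : List DStep) : Prop :=
  IsDualDecoratedPath w ∧ dheight w = 0

/-- The dual path has a peak at level 1: some up-step (`U` or `V`) taken from
height 0 is immediately followed by a `D`. -/
def DualHasPeakAtLevelOne (w : List DStep) : Prop :=
  ∃ p q : List DStep, ∃ u : DStep, (u = DStep.U ∨ u = DStep.V) ∧
    w = p ++ u :: DStep.D :: q ∧ dheight p = 0

/-- The number of partial dual decorated paths of length `n` (any nonnegative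
final height) having no peak at level 1. -/
noncomputable def dualPartialCount (n : ℕ) : ℕ :=
  Nat.card {w : List DStep // w.length = n ∧ IsDualDecoratedPath w ∧ ¬ DualHasPeakAtLevelOne w}

/-- Is `a`, taken from height `h`, allowed to be followed by the word `w`? -/
def pairOk (h : ℤ) (a : DStep) : List DStep → Bool
  | [] => true
  | b :: _ => match a, b with
    | DStep.U, DStep.D => !(decide (h = 0))
    | DStep.V, DStep.D => false
    | DStep.D, DStep.V => false
    | _, _ => true

/-- Boolean check of all the conditions, starting from height `h`. -/
def okPath : ℤ → List DStep → Bool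
  | h, [] => decide (0 ≤ h)
  | h, a :: w => decide (0 ≤ h) && (pairOk h a w && okPath (h + dstepVal a) w)

/-- The properties from height `h`. -/
def GoodFrom (h : ℤ) (w : List DStep) : Prop :=
  ((∀ p : List DStep, p <+: w → 0 ≤ h + dheight p) ∧
    ¬ [DStep.V, DStep.D] <:+: w ∧ ¬ [DStep.D, DStep.V] <:+: w) ∧
  ¬ ∃ p q : List DStep, ∃ u : DStep, (u = DStep.U ∨ u = DStep.V) ∧
    w = p ++ u :: DStep.D :: q ∧ h + dheight p = 0

theorem dheight_cons (a : DStep) (w : List DStep) :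
    dheight (a :: w) = dstepVal a + dheight w := by simp [dheight]

theorem prefix_cond (h : ℤ) (a : DStep) (w : List DStep) :
    (∀ p : List DStep, p <+: a :: w → 0 ≤ h + dheight p) ↔
      0 ≤ h ∧ ∀ p : List DStep, p <+: w → 0 ≤ h + dstepVal a + dheight p := by
  constructor
  · intro H
    refine ⟨by simpa [dheight] using H [] (List.nil_prefix), fun p hp => ?_⟩
    have := H (a :: p) (List.cons_prefix_cons.2 ⟨rfl, hp⟩)
    rw [dheight_cons] at this
    linarith
  · rintro ⟨h0, H⟩ p hp
    cases p with
    | nil => simpa [dheight] using h0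
    | cons b p =>
      obtain ⟨rfl, hq⟩ := List.cons_prefix_cons.1 hp
      rw [dheight_cons]
      linarith [H p hq]

theorem peak_cond (h : ℤ) (a : DStep) (w : List DStep) :
    (∃ p q : List DStep, ∃ u : DStep, (u = DStep.U ∨ u = DStep.V) ∧
      a :: w = p ++ u :: DStep.D :: q ∧ h + dheight p = 0) ↔
    ((a = DStep.U ∨ a = DStep.V) ∧ h = 0 ∧ ∃ q, w = DStep.D :: q) ∨
    (∃ p q : List DStep, ∃ u : DStep, (u = DStep.U ∨ u = DStep.V) ∧
      w = p ++ u :: DStep.D :: q ∧ h + dstepVal a + dheight p = 0) := by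
  constructor
  · rintro ⟨p, q, u, hu, hw, hh⟩
    cases p with
    | nil =>
      simp only [List.nil_append, List.cons.injEq] at hw
      obtain ⟨rfl, rfl⟩ := hw
      exact Or.inl ⟨hu, by simpa [dheight] using hh, q, rfl⟩
    | cons b p =>
      simp only [List.cons_append, List.cons.injEq] at hw
      obtain ⟨rfl, rfl⟩ := hw
      rw [dheight_cons] at hh
      exact Or.inr ⟨p, q, u, hu, rfl, by linarith⟩
  · rintro (⟨ha, h0, q, rfl⟩ | ⟨p, q, u, hu, rfl, hh⟩)
    · exact ⟨[], q, a, ha, rfl, by simp [dheight, h0]⟩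
    · exact ⟨a :: p, q, u, hu, rfl, by rw [dheight_cons]; linarith⟩

theorem pairOk_iff (h : ℤ) (a : DStep) (w : List DStep) :
    pairOk h a w = true ↔ ¬ ([DStep.V, DStep.D] <+: a :: w) ∧ ¬ ([DStep.D, DStep.V] <+: a :: w) ∧
      ¬ ((a = DStep.U ∨ a = DStep.V) ∧ h = 0 ∧ ∃ q, w = DStep.D :: q) := by
  cases w with
  | nil => simp [pairOk, List.cons_prefix_cons]
  | cons b w => cases a <;> cases b <;> simp [pairOk, List.cons_prefix_cons]

theorem okPath_iff (w : List DStep) : ∀ h : ℤ, okPath h w = true ↔ GoodFrom h w := by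
  induction w with
  | nil => intro h; simp [okPath, GoodFrom, dheight]
  | cons a w ih =>
    intro h
    simp only [okPath, Bool.and_eq_true, decide_eq_true_eq, ih, pairOk_iff]
    unfold GoodFrom
    rw [prefix_cond, peak_cond, List.infix_cons_iff, List.infix_cons_iff]
    simp only [not_or]
    constructor
    · rintro ⟨h1, ⟨h2, h3, h4⟩, ⟨h5, h6, h7⟩, h8⟩
      exact ⟨⟨⟨h1, h5⟩, ⟨h2, h6⟩, ⟨h3, h7⟩⟩, h4, h8⟩
    · rintro ⟨⟨⟨h1, h5⟩, ⟨h2, h6⟩, ⟨h3, h7⟩⟩, h4, h8⟩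
      exact ⟨h1, ⟨h2, h3, h4⟩, ⟨h5, h6, h7⟩, h8⟩

/-- All good words of length `n` from height `h`. -/
def genPaths : ℕ → ℤ → List (List DStep)
  | 0, h => if 0 ≤ h then [[]] else []
  | n + 1, h => if 0 ≤ h then
      [DStep.U, DStep.V, DStep.D].flatMap
        (fun a => ((genPaths n (h + dstepVal a)).filter (pairOk h a)).map (List.cons a))
    else []

theorem mem_genPaths (n : ℕ) : ∀ (h : ℤ) (w : List DStep),
    w ∈ genPaths n h ↔ w.length = n ∧ okPath h w = true := by
  induction n with
  | zero =>
    intro h w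
    unfold genPaths
    split_ifs with h0 <;> cases w <;> simp [okPath, h0]
  | succ n ih =>
    intro h w
    unfold genPaths
    split_ifs with h0
    · simp only [List.mem_flatMap, List.mem_map, List.mem_filter, ih]
      constructor
      · rintro ⟨a, -, v, ⟨⟨hl, hv⟩, hp⟩, rfl⟩
        simp [okPath, h0, hl, hv, hp]
      · rintro ⟨hl, hv⟩
        cases w with
        | nil => simp at hl
        | cons a v =>
          simp [okPath, h0] at hv hl
          exact ⟨a, by cases a <;> simp, v, ⟨⟨hl, hv.2⟩, hv.1⟩, rfl⟩
    · cases w <;> simp [okPath, h0]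

theorem nodup_genPaths (n : ℕ) : ∀ h : ℤ, (genPaths n h).Nodup := by
  induction n with
  | zero => intro h; unfold genPaths; split_ifs <;> simp
  | succ n ih =>
    intro h
    unfold genPaths
    split_ifs
    · rw [List.nodup_flatMap]
      refine ⟨fun a _ => ((ih _).filter _).map (List.cons_injective), ?_⟩
      simp [List.disjoint_left, Function.onFun]
      refine ⟨⟨?_, ?_⟩, ?_⟩ <;> · rintro _ x - - rfl y - -; simp
    · simp

theorem dualPartialCount_eq (n : ℕ) : dualPartialCount n = (genPaths n 0).length := by
  unfold dualPartialCount
  classical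
  rw [← List.toFinset_card_of_nodup (nodup_genPaths n 0)]
  apply Nat.subtype_card
  intro w
  rw [List.mem_toFinset, mem_genPaths, okPath_iff]
  simp [GoodFrom, IsDualDecoratedPath, DualHasPeakAtLevelOne]

theorem dual_partial_paths_initial_values :
    dualPartialCount 0 = 1 ∧ dualPartialCount 1 = 2 ∧ dualPartialCount 2 = 4 ∧
      dualPartialCount 3 = 10 ∧ dualPartialCount 4 = 24 ∧ dualPartialCount 5 = 56 ∧
      dualPartialCount 6 = 134 ∧ dualPartialCount 7 = 318 ∧ dualPartialCount 8 = 764 ∧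
      dualPartialCount 9 = 1824 := by
  simp only [dualPartialCount_eq]
  decide +kernel
end
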